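/- Fix λ > −1/2 and n ≥ 1, and let R_{λ,n+1}(x,y) be the kernel of the (n+1)-st Riesz transform associated with the Bessel operator Δ_λ^{(n+1)} on ℝ^{n+1}_+. Then: (i) there exist constants C̃ > 0 and c̃ ≥ 1 such that for every (x,y) with 0 < x_{n+1} ≤ y_{n+1}/c̃ and (λ+1/2)/(λ+1) < y_{n+1}²/(y_{n+1}² + |x′−y′|²) < 1, the kernel R_{λ,n+1}(x,y) does not change sign and |R_{λ,n+1}(x,y)| ≥ C̃ x_{n+1}/(y_{n+1}² + |x′−y′|²)^{n/2+λ+1}; (ii) there exists a constant C_n > 0 such that for all (x,y), R_{λ,n+1}(x,y) = C_n (y_{n+1} − x_{n+1})/((x_{n+1}y_{n+1})^λ |x−y|^{n+2}) + O(1/(x_{n+1}^{λ} y_{n+1}^{λ+1} |x−y|^{n})). -/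

import Mathlib

open MeasureTheory Set

noncomputable section

/-- The modified Bessel function of the first kind,
`I_ν(z) = ∑_{k≥0} (z/2)^{2k+ν} / (k! Γ(k+ν+1))`. -/
def besselI (ν z : ℝ) : ℝ :=
  ∑' k : ℕ, (z / 2) ^ (2 * (k : ℝ) + ν) / ((Nat.factorial k : ℝ) * Real.Gamma ((k : ℝ) + ν + 1))

/-- The Bessel heat kernel
`W_t^λ(x,y) = ((xy)^{-λ+1/2}/(2t)) e^{-(x²+y²)/(4t)} I_{λ-1/2}(xy/(2t))`. -/
def besselHeat (lam t x y : ℝ) : ℝ :=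
  (x * y) ^ (-lam + 1 / 2) / (2 * t) * Real.exp (-(x ^ 2 + y ^ 2) / (4 * t)) *
    besselI (lam - 1 / 2) (x * y / (2 * t))

/-- Points of the upper half-space `ℝ^{n+1}_+ = ℝ^n × (0,∞)`, written `x = (x', x_{n+1})`. -/
abbrev HalfPt (n : ℕ) := (Fin n → ℝ) × ℝ

/-- `|x' - y'|²`, the squared horizontal distance. -/
def horizSq (n : ℕ) (x y : HalfPt n) : ℝ := ∑ i, (x.1 i - y.1 i) ^ 2

/-- The Euclidean distance `|x - y|` on `ℝ^{n+1}`. -/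
def fullDist (n : ℕ) (x y : HalfPt n) : ℝ :=
  Real.sqrt (horizSq n x y + (x.2 - y.2) ^ 2)

/-- The heat kernel of the Bessel operator `Δ_λ^{(n+1)}` on `ℝ^{n+1}_+`:
`p_t(x,y) = (4πt)^{-n/2} e^{-|x'-y'|²/(4t)} W_t^λ(x_{n+1}, y_{n+1})`. -/
def besselHeatFull (n : ℕ) (lam t : ℝ) (x y : HalfPt n) : ℝ :=
  (4 * Real.pi * t) ^ (-(n : ℝ) / 2) * Real.exp (-(horizSq n x y) / (4 * t)) *
    besselHeat lam t x.2 y.2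

/-- The kernel of the Riesz transform `R_{λ,j} = (d/dx_j)(Δ_λ^{(n+1)})^{-1/2}`,
`1 ≤ j ≤ n`:  `R_{λ,j}(x,y) = (1/√π) ∂_{x_j} ∫₀^∞ p_t(x,y) dt/√t`. -/
def rieszKerJ (n : ℕ) (lam : ℝ) (j : Fin n) (x y : HalfPt n) : ℝ :=
  (Real.sqrt Real.pi)⁻¹ *
    deriv (fun s => ∫ t in Ioi (0 : ℝ),
      besselHeatFull n lam t (Function.update x.1 j s, x.2) y / Real.sqrt t) (x.1 j)

/-- The kernel of `R_{λ,n+1} = (d/dx_{n+1})(Δ_λ^{(n+1)})^{-1/2}`. -/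
def rieszKerLast (n : ℕ) (lam : ℝ) (x y : HalfPt n) : ℝ :=
  (Real.sqrt Real.pi)⁻¹ *
    deriv (fun s => ∫ t in Ioi (0 : ℝ),
      besselHeatFull n lam t (x.1, s) y / Real.sqrt t) x.2

theorem ringChoose_eq_Gamma {a : ℝ} (ha : 0 < a) (k : ℕ) :
    Ring.choose (a + k - 1) k = Real.Gamma (k + a) / (k.factorial * Real.Gamma a) := by
  have hG := Real.Gamma_pos_of_pos ha
  have hasc : (ascPochhammer ℕ k).smeval a = Real.Gamma (k + a) / Real.Gamma a := by
    induction k with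
    | zero => simp [hG.ne']
    | succ k ih =>
      rw [ascPochhammer_succ_right, Polynomial.smeval_mul, ih]
      have h : Real.Gamma ((k + 1 : ℕ) + a) = (k + a) * Real.Gamma (k + a) := by
        rw [← Real.Gamma_add_one (by positivity)]; push_cast; ring_nf
      rw [h]
      simp [Polynomial.smeval_add, Polynomial.smeval_natCast]
      ring
  have h := Ring.factorial_nsmul_multichoose_eq_ascPochhammer a k
  rw [hasc, nsmul_eq_mul] at h
  rw [Ring.choose, show a + k - 1 - k + 1 = a by ring, div_mul_eq_div_div_swap, ← h]
  field_simp

theorem hasSum_Gamma_mul_pow {a z : ℝ} (ha : 0 < a) (hz : |z| < 1) :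
    HasSum (fun k : ℕ => Real.Gamma (k + a) / k.factorial * z ^ k)
      (Real.Gamma a * (1 - z) ^ (-a)) := by
  have hG := Real.Gamma_pos_of_pos ha
  have h := (Real.one_div_one_sub_rpow_hasFPowerSeriesOnBall_zero a).hasSum (y := z)
    (by simpa [enorm_eq_nnnorm, ← NNReal.coe_lt_coe] using hz)
  have h2 := h.mul_left (Real.Gamma a)
  rw [zero_add, one_div, ← Real.rpow_neg (by linarith [abs_lt.1 hz])] at h2
  have e : (fun k : ℕ => Real.Gamma (k + a) / k.factorial * z ^ k) = fun k : ℕ =>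
      Real.Gamma a * (FormalMultilinearSeries.ofScalars ℝ
        (fun n : ℕ => Ring.choose (a + n - 1) n) k) fun _ => z := by
    funext k
    rw [FormalMultilinearSeries.ofScalars_apply_eq, smul_eq_mul, ringChoose_eq_Gamma ha]
    field_simp
  rw [e]
  exact h2

/-- A real sequence with `|ℓ (k+1) - ℓ k| ≤ C / (k+1)^2` converges with rate `1/(k+1)`. -/
theorem exists_limit_of_abs_sub_le {l : ℕ → ℝ} {C : ℝ} (hC : 0 ≤ C)
    (h : ∀ k, |l (k + 1) - l k| ≤ C / ((k : ℝ) + 1) ^ 2) :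
    ∃ L, ∀ k, |l k - L| ≤ 2 * C / ((k : ℝ) + 1) := by
  have step : ∀ k : ℕ, C / ((k : ℝ) + 1) ^ 2 ≤ 2 * C / (k + 1) - 2 * C / (k + 1 + 1) := by
    intro k
    have : 2 * C / ((k : ℝ) + 1) - 2 * C / (k + 1 + 1) - C / ((k : ℝ) + 1) ^ 2
      = C * k / ((k + 1) ^ 2 * (k + 1 + 1)) := by field_simp; ring
    have : 0 ≤ C * k / (((k : ℝ) + 1) ^ 2 * (k + 1 + 1)) := by positivity
    linarith
  have tele : ∀ k m : ℕ, k ≤ m → |l k - l m| ≤ 2 * C / ((k : ℝ) + 1) - 2 * C / (m + 1) := by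
    intro k m hkm
    induction m, hkm using Nat.le_induction with
    | base => simp
    | succ m _ ih =>
      have h1 := abs_sub_le (l k) (l m) (l (m + 1))
      have h2 := h m
      rw [abs_sub_comm] at h2
      have h3 := step m
      push_cast
      linarith
  have bd : ∀ k m : ℕ, k ≤ m → dist (l k) (l m) ≤ 2 * C / ((k : ℝ) + 1) := by
    intro k m hkm
    rw [Real.dist_eq]
    have : 0 ≤ 2 * C / ((m : ℝ) + 1) := by positivity
    linarith [tele k m hkm]
  have hcau : CauchySeq l := by
    refine cauchySeq_of_le_tendsto_0' _ bd ?_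
    have := tendsto_one_div_add_atTop_nhds_zero_nat (𝕜 := ℝ) |>.const_mul (2 * C)
    simpa [div_eq_mul_inv] using this
  obtain ⟨L, hL⟩ := cauchySeq_tendsto_of_complete hcau
  refine ⟨L, fun k => ?_⟩
  rw [← Real.dist_eq]
  refine le_of_tendsto (tendsto_const_nhds.dist hL) ?_
  filter_upwards [Filter.eventually_ge_atTop k] with m hm using bd k m hm

theorem exists_pos_limit_of_ratio {r : ℕ → ℝ} (hr : ∀ k, 0 < r k) {C : ℝ} (hC : 0 ≤ C)
    (h1 : ∀ k, r (k + 1) / r k - 1 ≤ C / ((k : ℝ) + 1) ^ 2)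
    (h2 : ∀ k, r k / r (k + 1) - 1 ≤ C / ((k : ℝ) + 1) ^ 2) :
    ∃ L M, 0 < L ∧ 0 < M ∧ (∀ k, |r k - L| ≤ M / ((k : ℝ) + 1)) := by
  obtain ⟨L, hL⟩ := exists_limit_of_abs_sub_le (l := fun k => Real.log (r k)) hC (by
    intro k
    have e1 := Real.log_le_sub_one_of_pos (div_pos (hr (k + 1)) (hr k))
    have e2 := Real.log_le_sub_one_of_pos (div_pos (hr k) (hr (k + 1)))
    rw [Real.log_div (hr _).ne' (hr _).ne'] at e1 e2
    rw [abs_le]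
    constructor <;> linarith [h1 k, h2 k])
  refine ⟨Real.exp L, Real.exp L * (Real.exp (2 * C) * (2 * C) + 1), Real.exp_pos _,
    by positivity, fun k => ?_⟩
  set u := Real.log (r k) - L with hu
  have hru : r k = Real.exp L * Real.exp u := by
    rw [← Real.exp_add, hu, add_sub_cancel, Real.exp_log (hr k)]
  have hk : 2 * C / ((k : ℝ) + 1) ≤ 2 * C :=
    div_le_self (by positivity) (by linarith [Nat.cast_nonneg (α := ℝ) k])
  have hu' : |u| ≤ 2 * C / ((k : ℝ) + 1) := hL k
  have hexp : |Real.exp u - 1| ≤ Real.exp (2 * C) * |u| := by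
    have hle : u ≤ 2 * C := (le_abs_self u).trans (hu'.trans hk)
    have a1 := Real.add_one_le_exp u
    have a2 := Real.add_one_le_exp (-u)
    have a3 : Real.exp u * Real.exp (-u) = 1 := by rw [← Real.exp_add]; simp
    have a4 : Real.exp u ≤ Real.exp (2 * C) := Real.exp_le_exp.2 hle
    have a5 : 1 ≤ Real.exp (2 * C) := Real.one_le_exp (by positivity)
    rw [abs_le]
    constructor
    · nlinarith [neg_abs_le u, abs_nonneg u]
    · have : Real.exp u - 1 ≤ Real.exp u * u := by nlinarith [Real.exp_pos u]
      nlinarith [le_abs_self u, abs_nonneg u, Real.exp_pos u]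
  rw [hru, show Real.exp L * Real.exp u - Real.exp L = Real.exp L * (Real.exp u - 1) by ring,
    abs_mul, abs_of_pos (Real.exp_pos L), mul_div_assoc]
  gcongr
  rw [add_div]
  calc _ ≤ Real.exp (2 * C) * |u| := hexp
    _ ≤ Real.exp (2 * C) * (2 * C / (k + 1)) := by gcongr
    _ = Real.exp (2 * C) * (2 * C) / (k + 1) := by ring
    _ ≤ _ := by linarith [show 0 ≤ 1 / ((k : ℝ) + 1) by positivity]

/-- The Taylor coefficients of the function `rieszSeries`. -/
def rieszCoeff (p lam : ℝ) (k : ℕ) : ℝ :=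
  Real.Gamma (p + lam + 2 * k) / (4 ^ k * k.factorial * Real.Gamma (k + lam + 1 / 2))

theorem rieszCoeff_pos {p lam : ℝ} (hl : -(1 / 2) < lam) (hp : 1 / 2 ≤ p) (k : ℕ) :
    0 < rieszCoeff p lam k := by
  have hk : (0 : ℝ) ≤ k := Nat.cast_nonneg k
  have h1 := Real.Gamma_pos_of_pos (show 0 < p + lam + 2 * k by linarith)
  have h2 := Real.Gamma_pos_of_pos (show 0 < k + lam + 1 / 2 by linarith)
  unfold rieszCoeff
  positivity

theorem rieszCoeff_succ {p lam : ℝ} (hl : -(1 / 2) < lam) (hp : 1 / 2 ≤ p) (k : ℕ) :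
    rieszCoeff p lam (k + 1) * ((k + 1) * (k + lam + 1 / 2)) =
      rieszCoeff p lam k * ((k + (p + lam) / 2) * (k + (p + lam) / 2 + 1 / 2)) := by
  have hk : (0 : ℝ) ≤ k := Nat.cast_nonneg k
  have hc : 0 < k + lam + 1 / 2 := by linarith
  have hm : 0 < p + lam + 2 * k := by linarith
  have h2 := Real.Gamma_pos_of_pos hc
  have e1 : Real.Gamma (p + lam + 2 * (k + 1 : ℕ)) =
      (p + lam + 2 * k + 1) * ((p + lam + 2 * k) * Real.Gamma (p + lam + 2 * k)) := by
    rw [← Real.Gamma_add_one hm.ne', ← Real.Gamma_add_one (by positivity)]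
    push_cast; ring_nf
  have e2 : Real.Gamma ((k + 1 : ℕ) + lam + 1 / 2) =
      (k + lam + 1 / 2) * Real.Gamma (k + lam + 1 / 2) := by
    rw [← Real.Gamma_add_one hc.ne']
    push_cast; ring_nf
  unfold rieszCoeff
  rw [e1, e2, pow_succ, Nat.factorial_succ]
  push_cast
  generalize (k : ℝ) + lam + 1 / 2 = c at *
  field_simp
  ring

theorem mul_div_mul_sub_one_le {a b c d m x : ℝ} (hm : 0 < m) (hm1 : m ≤ 1) (hc : m ≤ c)
    (hd : m ≤ d) (hx : 0 ≤ x) (habcd : a + b = c + d) :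
    (x + a) * (x + b) / ((x + c) * (x + d)) - 1 ≤ (|a * b - c * d| / m ^ 2) / (x + 1) ^ 2 := by
  have h1 : m * (x + 1) ≤ x + c := by nlinarith
  have h2 : m * (x + 1) ≤ x + d := by nlinarith
  have h0 : 0 < m * (x + 1) := by positivity
  have h3 : (m * (x + 1)) * (m * (x + 1)) ≤ (x + c) * (x + d) := by gcongr; linarith
  have h4 : 0 < (x + c) * (x + d) := by nlinarith
  rw [div_sub_one h4.ne', div_div, show m ^ 2 * (x + 1) ^ 2 = m * (x + 1) * (m * (x + 1)) by ring,
    show (x + a) * (x + b) - (x + c) * (x + d) = a * b - c * d + x * ((a + b) - (c + d)) by ring,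
    habcd, sub_self, mul_zero, add_zero]
  exact div_le_div₀ (abs_nonneg _) (le_abs_self _) (by positivity) h3

theorem exists_rieszCoeff_asymptotics {p lam : ℝ} (hl : -(1 / 2) < lam) (hp : 1 / 2 ≤ p) :
    ∃ L M, 0 < L ∧ 0 < M ∧ ∀ k : ℕ,
      |rieszCoeff p lam k - L * (Real.Gamma (k + p) / k.factorial)| ≤
        M * (Real.Gamma (k + p) / k.factorial) / ((k : ℝ) + 1) := by
  have hg : ∀ k : ℕ, 0 < Real.Gamma (k + p) / k.factorial := fun k => by
    have := Real.Gamma_pos_of_pos (show 0 < k + p by positivity)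
    positivity
  have hq := rieszCoeff_pos (p := p) hl hp
  set r : ℕ → ℝ := fun k => rieszCoeff p lam k / (Real.Gamma (k + p) / k.factorial) with hrdef
  have hr : ∀ k, 0 < r k := fun k => div_pos (hq k) (hg k)
  set m := min (min ((p + lam) / 2) (lam + 1 / 2)) (min p 1) with hmdef
  have hm : 0 < m := by simp only [hmdef, lt_min_iff]; refine ⟨⟨?_, ?_⟩, ?_, ?_⟩ <;> linarith
  have m1 : m ≤ (p + lam) / 2 := (min_le_left _ _).trans (min_le_left _ _)
  have m2 : m ≤ lam + 1 / 2 := (min_le_left _ _).trans (min_le_right _ _)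
  have m3 : m ≤ p := (min_le_right _ _).trans (min_le_left _ _)
  have m4 : m ≤ 1 := (min_le_right _ _).trans (min_le_right _ _)
  have hgs : ∀ k : ℕ, Real.Gamma ((k + 1 : ℕ) + p) / (k + 1).factorial * (k + 1) =
      (k + p) * (Real.Gamma (k + p) / k.factorial) := fun k => by
    have e : Real.Gamma ((k + 1 : ℕ) + p) = (k + p) * Real.Gamma (k + p) := by
      rw [← Real.Gamma_add_one (by positivity)]; push_cast; ring_nf
    rw [e, Nat.factorial_succ]; push_cast; field_simp
  have hrr : ∀ k : ℕ, r (k + 1) * ((k + (lam + 1 / 2)) * (k + p)) =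
      r k * ((k + (p + lam) / 2) * (k + ((p + lam) / 2 + 1 / 2))) := fun k => by
    have e1 := rieszCoeff_succ (p := p) hl hp k
    have e2 := hgs k
    have p1 := hg k
    have p2 := hg (k + 1)
    simp only [hrdef]
    generalize Real.Gamma (k + p) / k.factorial = g at *
    generalize Real.Gamma ((k + 1 : ℕ) + p) / (k + 1).factorial = g' at *
    rw [div_mul_eq_mul_div, div_mul_eq_mul_div, div_eq_div_iff p2.ne' p1.ne']
    have hk1 : (0 : ℝ) < k + 1 := by positivity
    apply mul_right_cancel₀ hk1.ne'
    linear_combination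
      (rieszCoeff p lam (k + 1) * (k + (lam + 1 / 2)) * (k + 1)) * (-e2) + g' * (k + 1) * e1
  obtain ⟨L, M, hL, hM, hLM⟩ := exists_pos_limit_of_ratio hr
    (C := |(p + lam) / 2 * ((p + lam) / 2 + 1 / 2) - (lam + 1 / 2) * p| / m ^ 2) (by positivity)
    (by
      intro k
      have := mul_div_mul_sub_one_le hm m4 m2 m3 (Nat.cast_nonneg (α := ℝ) k)
        (show (p + lam) / 2 + ((p + lam) / 2 + 1 / 2) = (lam + 1 / 2) + p by ring)
      convert this using 2
      have hk : (0 : ℝ) ≤ k := Nat.cast_nonneg k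
      have h1 : 0 < (k + (lam + 1 / 2)) * (k + p) := by apply mul_pos <;> linarith
      rw [div_eq_div_iff (hr k).ne' h1.ne', hrr k, mul_comm])
    (by
      intro k
      have := mul_div_mul_sub_one_le hm m4 m1 (show m ≤ (p + lam) / 2 + 1 / 2 by linarith)
        (Nat.cast_nonneg (α := ℝ) k)
        (show (lam + 1 / 2) + p = (p + lam) / 2 + ((p + lam) / 2 + 1 / 2) by ring)
      rw [abs_sub_comm] at this
      convert this using 2
      have hk : (0 : ℝ) ≤ k := Nat.cast_nonneg k
      have h1 : 0 < (k + (p + lam) / 2) * (k + ((p + lam) / 2 + 1 / 2)) := by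
        apply mul_pos <;> linarith
      rw [div_eq_div_iff (hr (k + 1)).ne' h1.ne', ← hrr k, mul_comm])
  refine ⟨L, M, hL, hM, fun k => ?_⟩
  have h := hLM k
  have e : rieszCoeff p lam k = r k * (Real.Gamma (k + p) / k.factorial) :=
    (div_mul_cancel₀ _ (hg k).ne').symm
  rw [e, ← sub_mul, abs_mul, abs_of_pos (hg k)]
  calc _ ≤ M / ((k : ℝ) + 1) * (Real.Gamma (k + p) / k.factorial) :=
        mul_le_mul_of_nonneg_right h (hg k).le
    _ = _ := by ring

theorem abs_succ_mul_rieszCoeff_sub_le {p lam L M : ℝ} (hp : 1 / 2 ≤ p) (hM : 0 ≤ M)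
    (h : ∀ k : ℕ, |rieszCoeff p lam k - L * (Real.Gamma (k + p) / k.factorial)| ≤
        M * (Real.Gamma (k + p) / k.factorial) / ((k : ℝ) + 1)) (k : ℕ) :
    |(k + 1) * rieszCoeff p lam (k + 1) - L * (Real.Gamma (k + (p + 1)) / k.factorial)| ≤
      M * (1 + p) * (Real.Gamma (k + p) / k.factorial) := by
  have hk : (0 : ℝ) ≤ k := Nat.cast_nonneg k
  have hG := Real.Gamma_pos_of_pos (show 0 < k + p by positivity)
  have e : Real.Gamma ((k + 1 : ℕ) + p) = Real.Gamma (k + (p + 1)) := by push_cast; ring_nf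
  have e' : Real.Gamma (k + (p + 1)) = (k + p) * Real.Gamma (k + p) := by
    rw [← Real.Gamma_add_one (by positivity)]; ring_nf
  have h1 := mul_le_mul_of_nonneg_left (h (k + 1)) (show (0 : ℝ) ≤ k + 1 by positivity)
  rw [← abs_of_nonneg (show (0 : ℝ) ≤ k + 1 by positivity), ← abs_mul,
    abs_of_nonneg (show (0 : ℝ) ≤ k + 1 by positivity), e, Nat.factorial_succ] at h1
  push_cast at h1
  rw [show (k + 1) * (rieszCoeff p lam (k + 1) -
      L * (Real.Gamma (k + (p + 1)) / ((k + 1) * k.factorial))) =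
      (k + 1) * rieszCoeff p lam (k + 1) - L * (Real.Gamma (k + (p + 1)) / k.factorial) by
    field_simp] at h1
  refine h1.trans ?_
  rw [e', show (k + 1) * (M * ((k + p) * Real.Gamma (k + p) / ((k + 1) * k.factorial)) /
    ((k : ℝ) + 1 + 1)) = M * ((k + p) / (k + 2)) * (Real.Gamma (k + p) / k.factorial) by
      field_simp; ring]
  gcongr
  rw [div_le_iff₀ (by positivity)]
  nlinarith

/-- The power series governing the potential kernel of the Bessel operator. -/
def rieszSeries (p lam z : ℝ) : ℝ := ∑' k : ℕ, rieszCoeff p lam k * z ^ k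

/-- The termwise derivative of `rieszSeries`. -/
def rieszSeriesDeriv (p lam z : ℝ) : ℝ := ∑' k : ℕ, (k + 1) * rieszCoeff p lam (k + 1) * z ^ k

theorem summable_rieszCoeff_mul_pow {p lam : ℝ} (hl : -(1 / 2) < lam) (hp : 1 / 2 ≤ p)
    {z : ℝ} (hz : |z| < 1) :
    Summable fun k : ℕ => rieszCoeff p lam k * z ^ k := by
  obtain ⟨L, M, hL, hM, h⟩ := exists_rieszCoeff_asymptotics hl hp
  have hs := (hasSum_Gamma_mul_pow (a := p) (z := |z|) (by linarith)
    (by simpa using hz)).summable.mul_left (L + M)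
  refine Summable.of_norm_bounded hs fun k => ?_
  have hG := Real.Gamma_pos_of_pos (show 0 < k + p by positivity)
  rw [Real.norm_eq_abs, abs_mul, abs_pow, ← mul_assoc, abs_of_pos (rieszCoeff_pos hl hp k)]
  gcongr
  have h1 := (le_abs_self _).trans (h k)
  have h2 : M * (Real.Gamma (k + p) / k.factorial) / ((k : ℝ) + 1) ≤
      M * (Real.Gamma (k + p) / k.factorial) :=
    div_le_self (by positivity) (by linarith [Nat.cast_nonneg (α := ℝ) k])
  linarith

theorem summable_succ_mul_rieszCoeff_mul_pow {p lam : ℝ} (hl : -(1 / 2) < lam) (hp : 1 / 2 ≤ p)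
    {z : ℝ} (hz : |z| < 1) :
    Summable fun k : ℕ => (k + 1) * rieszCoeff p lam (k + 1) * z ^ k := by
  obtain ⟨L, M, hL, hM, h⟩ := exists_rieszCoeff_asymptotics hl hp
  have hz' : |(|z|)| < 1 := by simpa using hz
  have hs := ((hasSum_Gamma_mul_pow (a := p) (by linarith) hz').summable.mul_left
    (M * (1 + p))).add
    ((hasSum_Gamma_mul_pow (a := p + 1) (by linarith) hz').summable.mul_left L)
  refine Summable.of_norm_bounded hs fun k => ?_
  have hq := rieszCoeff_pos (p := p) hl hp (k + 1)
  have h1 := (le_abs_self _).trans (abs_succ_mul_rieszCoeff_sub_le hp hM.le h k)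
  rw [Real.norm_eq_abs, abs_mul, abs_pow, ← mul_assoc, ← mul_assoc, ← add_mul,
    abs_of_nonneg (by positivity)]
  gcongr
  linarith

theorem hasDerivAt_rieszSeries {p lam : ℝ} (hl : -(1 / 2) < lam) (hp : 1 / 2 ≤ p)
    {z : ℝ} (hz : |z| < 1) :
    HasDerivAt (rieszSeries p lam) (rieszSeriesDeriv p lam z) z := by
  set ρ := (1 + |z|) / 2 with hρ
  have hρ0 : 0 ≤ ρ := by positivity
  have hzρ : |z| < ρ := by linarith
  have hρ1 : |ρ| < 1 := by rw [abs_of_nonneg hρ0]; linarith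
  have shift : ∀ y : ℝ, |y| < 1 →
      Summable fun k : ℕ => rieszCoeff p lam k * (k * y ^ (k - 1)) := fun y hy => by
    rw [← summable_nat_add_iff 1]
    refine (summable_succ_mul_rieszCoeff_mul_pow hl hp hy).congr fun k => ?_
    rw [Nat.add_sub_cancel]; push_cast; ring
  have key := hasDerivAt_tsum_of_isPreconnected (shift ρ hρ1) (isOpen_Ioo (a := -ρ) (b := ρ))
    (isPreconnected_Ioo) (g := fun k y => rieszCoeff p lam k * y ^ k)
    (g' := fun k y => rieszCoeff p lam k * (k * y ^ (k - 1)))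
    (fun k y _ => (hasDerivAt_pow k y).const_mul _) (fun k y hy => ?_)
    (abs_lt.1 hzρ) (summable_rieszCoeff_mul_pow hl hp hz) (abs_lt.1 hzρ)
  · have e : rieszSeriesDeriv p lam z = ∑' k : ℕ, rieszCoeff p lam k * (k * z ^ (k - 1)) := by
      rw [(shift z hz).tsum_eq_zero_add]
      simp only [rieszSeriesDeriv, Nat.cast_zero, zero_mul, mul_zero, zero_add,
        Nat.add_sub_cancel]
      refine tsum_congr fun k => ?_
      push_cast; ring
    rw [e]
    exact key
  · have hy' : |y| ≤ ρ := (abs_lt.2 hy).le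
    have hq := rieszCoeff_pos (p := p) hl hp k
    rw [Real.norm_eq_abs, abs_mul, abs_mul, abs_pow, abs_of_pos hq,
      abs_of_nonneg (Nat.cast_nonneg k)]
    gcongr

theorem rieszSeries_nonneg {p lam : ℝ} (hl : -(1 / 2) < lam) (hp : 1 / 2 ≤ p)
    {z : ℝ} (hz : 0 ≤ z) : 0 ≤ rieszSeries p lam z :=
  tsum_nonneg fun k => mul_nonneg (rieszCoeff_pos hl hp k).le (by positivity)

theorem le_rieszSeriesDeriv {p lam : ℝ} (hl : -(1 / 2) < lam) (hp : 1 / 2 ≤ p)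
    {z : ℝ} (hz : 0 ≤ z) (hz1 : z < 1) :
    rieszCoeff p lam 1 ≤ rieszSeriesDeriv p lam z := by
  have hs := summable_succ_mul_rieszCoeff_mul_pow (p := p) hl hp
    (show |z| < 1 by rwa [abs_of_nonneg hz])
  have := hs.le_tsum 0 fun k _ =>
    mul_nonneg (mul_nonneg (by positivity) (rieszCoeff_pos hl hp (k + 1)).le) (by positivity)
  simpa [rieszSeriesDeriv] using this

theorem exists_rieszSeries_bounds {p lam : ℝ} (hl : -(1 / 2) < lam) (hp : 1 / 2 ≤ p) :
    ∃ A C, 0 < A ∧ 0 < C ∧ ∀ z : ℝ, 0 ≤ z → z < 1 →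
    rieszSeries p lam z ≤ C * (1 - z) ^ (-p) ∧
    |rieszSeriesDeriv p lam z - A * (1 - z) ^ (-(p + 1))| ≤ C * (1 - z) ^ (-p) := by
  obtain ⟨L, M, hL, hM, h⟩ := exists_rieszCoeff_asymptotics hl hp
  have hp0 : 0 < p := by linarith
  have hGp := Real.Gamma_pos_of_pos hp0
  have hGp1 := Real.Gamma_pos_of_pos (show 0 < p + 1 by linarith)
  refine ⟨L * Real.Gamma (p + 1), (L + M * (1 + p)) * Real.Gamma p, by positivity, by positivity,
    fun z hz hz1 => ?_⟩
  have hz' : |z| < 1 := by rwa [abs_of_nonneg hz]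
  have hb := hasSum_Gamma_mul_pow hp0 hz'
  have hb1 := hasSum_Gamma_mul_pow (a := p + 1) (by linarith) hz'
  have hpos : 0 ≤ (1 - z) ^ (-p) := Real.rpow_nonneg (by linarith) _
  constructor
  · have hs := (hb.mul_left (L + M * (1 + p)))
    rw [← mul_assoc] at hs
    refine hasSum_le (fun k => ?_) (summable_rieszCoeff_mul_pow hl hp hz').hasSum hs
    have hG := Real.Gamma_pos_of_pos (show 0 < k + p by positivity)
    rw [← mul_assoc]
    refine mul_le_mul_of_nonneg_right ?_ (pow_nonneg hz k)
    have h1 := (le_abs_self _).trans (h k)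
    have h2 : M * (Real.Gamma (k + p) / k.factorial) / ((k : ℝ) + 1) ≤
        M * (Real.Gamma (k + p) / k.factorial) :=
      div_le_self (by positivity) (by linarith [Nat.cast_nonneg (α := ℝ) k])
    have h3 : 0 ≤ M * p * (Real.Gamma (k + p) / k.factorial) := by positivity
    linarith
  · have h1 := (summable_succ_mul_rieszCoeff_mul_pow (p := p) hl hp hz').hasSum.sub
      (hb1.mul_left L)
    have h2 := hb.mul_left (M * (1 + p))
    have hle := tsum_of_norm_bounded (f := fun k : ℕ =>
      (k + 1) * rieszCoeff p lam (k + 1) * z ^ k -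
        L * (Real.Gamma (k + (p + 1)) / k.factorial * z ^ k)) h2 (fun k => by
        rw [← mul_assoc, ← mul_assoc, ← sub_mul, Real.norm_eq_abs, abs_mul,
          abs_of_nonneg (pow_nonneg hz k)]
        exact mul_le_mul_of_nonneg_right (abs_succ_mul_rieszCoeff_sub_le hp hM.le h k)
          (pow_nonneg hz k))
    rw [h1.tsum_eq, Real.norm_eq_abs, ← mul_assoc, ← mul_assoc] at hle
    refine hle.trans ?_
    gcongr
    linarith

theorem integral_rpow_mul_exp_neg_div {m B : ℝ} (hm : 0 < m) (hB : 0 < B) :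
    IntegrableOn (fun t : ℝ => t ^ (-m - 1) * Real.exp (-B / t)) (Ioi 0) ∧
    ∫ t in Ioi (0 : ℝ), t ^ (-m - 1) * Real.exp (-B / t) = B ^ (-m) * Real.Gamma m := by
  set g : ℝ → ℝ := fun u => u ^ (m - 1) * Real.exp (-(B * u)) with hg
  have e : ∀ t ∈ Ioi (0 : ℝ), (|(-1 : ℝ)| * t ^ ((-1 : ℝ) - 1)) • g (t ^ (-1 : ℝ)) =
      t ^ (-m - 1) * Real.exp (-B / t) := by
    intro t ht
    have ht : 0 < t := ht
    simp only [hg, smul_eq_mul, abs_neg, abs_one, one_mul]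
    rw [← Real.rpow_mul ht.le, ← mul_assoc, ← Real.rpow_add ht, Real.rpow_neg_one]
    congr 2 <;> ring
  have hint : IntegrableOn g (Ioi 0) := by
    have := integrableOn_rpow_mul_exp_neg_mul_rpow (p := 1) (s := m - 1) (b := B)
      (by linarith) one_pos hB
    simpa [hg, neg_mul] using this
  constructor
  · exact ((integrableOn_Ioi_comp_rpow_iff g (by norm_num)).2 hint).congr_fun e measurableSet_Ioi
  · rw [← setIntegral_congr_fun measurableSet_Ioi e, integral_comp_rpow_Ioi g (by norm_num),
      Real.integral_rpow_mul_exp_neg_mul_Ioi hm hB, one_div, Real.inv_rpow hB.le,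
      Real.rpow_neg hB.le]

theorem besselHeatFull_div_sqrt {n : ℕ} {lam t : ℝ} {x y : HalfPt n} (hx : 0 < x.2) (hy : 0 < y.2)
    (ht : 0 < t) :
    besselHeatFull n lam t x y / Real.sqrt t = ∑' k : ℕ,
      (4 * Real.pi) ^ (-((n : ℝ) / 2)) / 2 * 4 ^ (-(2 * k + (lam - 1 / 2))) *
        (x.2 * y.2) ^ (2 * k) / (k.factorial * Real.Gamma (k + lam + 1 / 2)) *
      (t ^ (-((n : ℝ) / 2 + lam + 2 * k) - 1) *
        Real.exp (-((horizSq n x y + x.2 ^ 2 + y.2 ^ 2) / 4) / t)) := by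
  have hw : 0 < x.2 * y.2 := mul_pos hx hy
  unfold besselHeatFull besselHeat besselI
  rw [← tsum_mul_left, ← tsum_mul_left, ← tsum_div_const]
  refine tsum_congr fun k => ?_
  have a1 : (x.2 * y.2 / (2 * t) / 2) ^ (2 * (k : ℝ) + (lam - 1 / 2)) =
      (x.2 * y.2) ^ (2 * (k : ℝ) + (lam - 1 / 2)) * 4 ^ (-(2 * (k : ℝ) + (lam - 1 / 2))) *
        t ^ (-(2 * (k : ℝ) + (lam - 1 / 2))) := by
    rw [show x.2 * y.2 / (2 * t) / 2 = x.2 * y.2 * (4 * t)⁻¹ by field_simp; norm_num,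
      Real.mul_rpow hw.le (by positivity), Real.inv_rpow (by positivity),
      ← Real.rpow_neg (by positivity), Real.mul_rpow (by norm_num) ht.le, mul_assoc]
  have a2 : (x.2 * y.2) ^ (2 * k) =
      (x.2 * y.2) ^ (-lam + 1 / 2) * (x.2 * y.2) ^ (2 * (k : ℝ) + (lam - 1 / 2)) := by
    rw [← Real.rpow_add hw, ← Real.rpow_natCast]
    congr 1; push_cast; ring
  have a3 : t ^ (-((n : ℝ) / 2 + lam + 2 * k) - 1) =
      t ^ (-((n : ℝ) / 2)) * t ^ (-(2 * (k : ℝ) + (lam - 1 / 2))) * t⁻¹ * (Real.sqrt t)⁻¹ := by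
    rw [Real.sqrt_eq_rpow, ← Real.rpow_neg ht.le, ← Real.rpow_neg_one, ← Real.rpow_add ht,
      ← Real.rpow_add ht, ← Real.rpow_add ht]
    congr 1; ring
  have a4 : Real.exp (-((horizSq n x y + x.2 ^ 2 + y.2 ^ 2) / 4) / t) =
      Real.exp (-(horizSq n x y) / (4 * t)) * Real.exp (-(x.2 ^ 2 + y.2 ^ 2) / (4 * t)) := by
    rw [← Real.exp_add]; congr 1; field_simp; ring
  have a5 : (4 * Real.pi * t) ^ (-(n : ℝ) / 2) =
      (4 * Real.pi) ^ (-((n : ℝ) / 2)) * t ^ (-((n : ℝ) / 2)) := by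
    rw [neg_div, Real.mul_rpow (by positivity) ht.le]
  rw [a1, a2, a3, a4, a5, show (k : ℝ) + (lam - 1 / 2) + 1 = k + lam + 1 / 2 by ring]
  ring

theorem integral_besselHeatFull {n : ℕ} (hn : 1 ≤ n) {lam : ℝ} (hlam : -(1 / 2 : ℝ) < lam)
    {x y : HalfPt n} (hx : 0 < x.2) (hy : 0 < y.2)
    (hxy : 0 < horizSq n x y + (x.2 - y.2) ^ 2) :
    ∫ t in Ioi (0 : ℝ), besselHeatFull n lam t x y / Real.sqrt t =
      Real.pi ^ (-((n : ℝ) / 2)) *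
        ((horizSq n x y + x.2 ^ 2 + y.2 ^ 2) ^ (-((n : ℝ) / 2 + lam)) *
          rieszSeries (n / 2) lam
            ((2 * (x.2 * y.2) / (horizSq n x y + x.2 ^ 2 + y.2 ^ 2)) ^ 2)) := by
  have hw : 0 < x.2 * y.2 := mul_pos hx hy
  have hn' : (1 : ℝ) ≤ n := by exact_mod_cast hn
  set A := horizSq n x y + x.2 ^ 2 + y.2 ^ 2 with hA
  have hwA : 2 * (x.2 * y.2) < A := by rw [hA]; nlinarith
  have hA0 : 0 < A := by linarith
  rw [setIntegral_congr_fun measurableSet_Ioi fun t ht => besselHeatFull_div_sqrt hx hy ht]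
  set c : ℕ → ℝ := fun k => (4 * Real.pi) ^ (-((n : ℝ) / 2)) / 2 *
    4 ^ (-(2 * (k : ℝ) + (lam - 1 / 2))) *
        (x.2 * y.2) ^ (2 * k) / (k.factorial * Real.Gamma (k + lam + 1 / 2)) with hc
  have hm : ∀ k : ℕ, 0 < (n : ℝ) / 2 + lam + 2 * k := fun k => by
    linarith [Nat.cast_nonneg (α := ℝ) k]
  have hΓ : ∀ k : ℕ, 0 < Real.Gamma (k + lam + 1 / 2) := fun k =>
    Real.Gamma_pos_of_pos (by linarith [Nat.cast_nonneg (α := ℝ) k])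
  have hc0 : ∀ k, 0 ≤ c k := fun k => by have := hΓ k; simp only [hc]; positivity
  have hJ := fun k => integral_rpow_mul_exp_neg_div (hm k) (show 0 < A / 4 by positivity)
  have hval : ∀ k : ℕ, ∫ t in Ioi (0 : ℝ), c k * (t ^ (-((n : ℝ) / 2 + lam + 2 * k) - 1) *
        Real.exp (-(A / 4) / t)) = Real.pi ^ (-((n : ℝ) / 2)) * A ^ (-((n : ℝ) / 2 + lam)) *
        (rieszCoeff (n / 2) lam k * ((2 * (x.2 * y.2) / A) ^ 2) ^ k) := fun k => by
    rw [integral_const_mul, (hJ k).2]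
    have b1 : (4 * Real.pi) ^ (-((n : ℝ) / 2)) =
        4 ^ (-((n : ℝ) / 2)) * Real.pi ^ (-((n : ℝ) / 2)) :=
      Real.mul_rpow (by norm_num) Real.pi_pos.le
    have b2 : (A / 4) ^ (-((n : ℝ) / 2 + lam + 2 * k)) =
        A ^ (-((n : ℝ) / 2 + lam)) * (A ^ (2 * k))⁻¹ * 4 ^ ((n : ℝ) / 2 + lam + 2 * k) := by
      rw [Real.div_rpow hA0.le (by norm_num), Real.rpow_neg (by norm_num : (0 : ℝ) ≤ 4),
        div_inv_eq_mul, neg_add, Real.rpow_add hA0, Real.rpow_neg hA0.le (2 * k),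
        ← Real.rpow_natCast]
      push_cast; rfl
    have b3 : (4 : ℝ) ^ (-((n : ℝ) / 2)) * 4 ^ (-(2 * (k : ℝ) + (lam - 1 / 2))) *
        4 ^ ((n : ℝ) / 2 + lam + 2 * k) = 2 := by
      rw [← Real.rpow_add (by norm_num), ← Real.rpow_add (by norm_num),
        show -((n : ℝ) / 2) + -(2 * (k : ℝ) + (lam - 1 / 2)) + ((n : ℝ) / 2 + lam + 2 * k) = 1 / 2
          by ring, ← Real.sqrt_eq_rpow, show (4 : ℝ) = 2 ^ 2 by norm_num]
      simp
    have b4 : ((2 * (x.2 * y.2) / A) ^ 2) ^ k =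
        4 ^ k * (x.2 * y.2) ^ (2 * k) * (A ^ (2 * k))⁻¹ := by
      rw [show (2 * (x.2 * y.2) / A) ^ 2 = 4 * (x.2 * y.2) ^ 2 * (A ^ 2)⁻¹ by field_simp; norm_num,
        mul_pow, mul_pow, inv_pow, ← pow_mul, ← pow_mul]
    have h4 : (4 : ℝ) ^ k ≠ 0 := by positivity
    simp only [hc, rieszCoeff]
    rw [b1, b2, b4]
    generalize (4 : ℝ) ^ (-((n : ℝ) / 2)) = u1 at *
    generalize (4 : ℝ) ^ (-(2 * (k : ℝ) + (lam - 1 / 2))) = u2 at *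
    generalize (4 : ℝ) ^ ((n : ℝ) / 2 + lam + 2 * k) = u3 at *
    generalize Real.Gamma ((n : ℝ) / 2 + lam + 2 * k) = g
    calc _ = u1 * u2 * u3 / 2 * Real.pi ^ (-((n : ℝ) / 2)) * A ^ (-((n : ℝ) / 2 + lam)) *
          ((x.2 * y.2) ^ (2 * k) * (A ^ (2 * k))⁻¹) *
          (g / (k.factorial * Real.Gamma (k + lam + 1 / 2))) := by ring
      _ = Real.pi ^ (-((n : ℝ) / 2)) * A ^ (-((n : ℝ) / 2 + lam)) *
          ((x.2 * y.2) ^ (2 * k) * (A ^ (2 * k))⁻¹) *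
          (g / (k.factorial * Real.Gamma (k + lam + 1 / 2))) * (4 ^ k / 4 ^ k) := by
        rw [b3, div_self h4]; ring
      _ = _ := by ring
  have hz : |(2 * (x.2 * y.2) / A) ^ 2| < 1 := by
    rw [abs_pow, abs_of_nonneg (by positivity)]
    exact pow_lt_one₀ (by positivity) ((div_lt_one hA0).2 hwA) two_ne_zero
  have hs := summable_rieszCoeff_mul_pow (p := n / 2) hlam (by linarith) hz
  have key := hasSum_integral_of_summable_integral_norm
    (fun k : ℕ => (hJ k).1.const_mul (c k)) (by
      refine (hs.mul_left (Real.pi ^ (-((n : ℝ) / 2)) * A ^ (-((n : ℝ) / 2 + lam)))).congr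
        fun k => ?_
      rw [← hval k]
      refine setIntegral_congr_fun measurableSet_Ioi fun t ht => ?_
      have ht : 0 < t := ht
      have := hc0 k
      exact (Real.norm_of_nonneg (by positivity)).symm)
  rw [← key.tsum_eq, tsum_congr hval, tsum_mul_left, mul_assoc]
  rfl

theorem rieszKerLast_eq {n : ℕ} (hn : 1 ≤ n) {lam : ℝ} (hlam : -(1 / 2 : ℝ) < lam)
    {x y : HalfPt n} {A : ℝ} (hA : A = horizSq n x y + x.2 ^ 2 + y.2 ^ 2)
    (hx : 0 < x.2) (hy : 0 < y.2) (hxy : 0 < horizSq n x y + (x.2 - y.2) ^ 2) :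
    rieszKerLast n lam x y =
      (Real.sqrt Real.pi)⁻¹ * Real.pi ^ (-((n : ℝ) / 2)) *
        A ^ (-((n : ℝ) / 2 + lam) - 1) * (2 * x.2) *
        (4 * (y.2 ^ 2 * (A - 2 * x.2 ^ 2) / A ^ 2) *
          rieszSeriesDeriv (n / 2) lam ((2 * (x.2 * y.2) / A) ^ 2) -
          ((n : ℝ) / 2 + lam) * rieszSeries (n / 2) lam ((2 * (x.2 * y.2) / A) ^ 2)) := by
  have hn' : (1 : ℝ) ≤ n := by exact_mod_cast hn
  have hw : 0 < x.2 * y.2 := mul_pos hx hy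
  have hwA : 2 * (x.2 * y.2) < A := by rw [hA]; nlinarith
  have hA0 : 0 < A := by linarith
  set h := horizSq n x y with hh
  have hz : |(2 * (x.2 * y.2) / A) ^ 2| < 1 := by
    rw [abs_pow, abs_of_nonneg (by positivity)]
    exact pow_lt_one₀ (by positivity) ((div_lt_one hA0).2 hwA) two_ne_zero
  have hev : (fun s => ∫ t in Ioi (0 : ℝ), besselHeatFull n lam t (x.1, s) y / Real.sqrt t) =ᶠ[
      nhds x.2] fun s => Real.pi ^ (-((n : ℝ) / 2)) * ((h + s ^ 2 + y.2 ^ 2) ^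
        (-((n : ℝ) / 2 + lam)) * rieszSeries (n / 2) lam
          ((2 * (s * y.2) / (h + s ^ 2 + y.2 ^ 2)) ^ 2)) := by
    have hcont : Continuous fun s : ℝ => h + (s - y.2) ^ 2 := by fun_prop
    filter_upwards [lt_mem_nhds hx, hcont.continuousAt.eventually (lt_mem_nhds hxy)] with s hs hs'
    exact integral_besselHeatFull hn hlam (x := (x.1, s)) hs hy hs'
  have dA : HasDerivAt (fun s : ℝ => h + s ^ 2 + y.2 ^ 2) (2 * x.2) x.2 := by
    simpa using ((hasDerivAt_pow 2 x.2).const_add h).add_const (y.2 ^ 2)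
  rw [hA] at hA0 hz
  have dpow := dA.rpow_const (p := -((n : ℝ) / 2 + lam)) (Or.inl hA0.ne')
  have dnum : HasDerivAt (fun s : ℝ => 2 * (s * y.2)) (2 * y.2) x.2 := by
    simpa using ((hasDerivAt_id x.2).mul_const y.2).const_mul 2
  have dz := (dnum.div dA hA0.ne').pow 2
  have dH := (hasDerivAt_rieszSeries (p := n / 2) hlam (by linarith) hz).comp x.2 dz
  have dF := (dpow.mul dH).const_mul (Real.pi ^ (-((n : ℝ) / 2)))
  have e := (dF.congr_of_eventuallyEq hev).deriv
  unfold rieszKerLast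
  rw [e]
  have hsplit : (h + x.2 ^ 2 + y.2 ^ 2) ^ (-((n : ℝ) / 2 + lam)) =
      (h + x.2 ^ 2 + y.2 ^ 2) ^ (-((n : ℝ) / 2 + lam) - 1) * (h + x.2 ^ 2 + y.2 ^ 2) := by
    rw [← Real.rpow_add_one hA0.ne']; congr 1; ring
  simp only [Function.comp_apply, Pi.div_apply, Pi.pow_apply]
  rw [hsplit, ← hA]
  rw [← hA] at hA0
  norm_num only
  generalize rieszSeriesDeriv ((n : ℝ) / 2) lam ((2 * (x.2 * y.2) / A) ^ 2) = H'
  generalize rieszSeries ((n : ℝ) / 2) lam ((2 * (x.2 * y.2) / A) ^ 2) = H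
  generalize A ^ (-((n : ℝ) / 2 + lam) - 1) = P
  field_simp
  ring

theorem one_sub_rpow_le {u r : ℝ} (hu : 0 < u) (hu1 : u ≤ 1) (hr : 0 < r) :
    1 - u ^ r ≤ (r + 1) * (1 - u) := by
  have h1 : u ^ (r + 1) ≤ u ^ r := Real.rpow_le_rpow_of_exponent_ge hu hu1 (by linarith)
  have h2 := one_add_mul_self_le_rpow_one_add (s := u - 1) (p := r + 1) (by linarith) (by linarith)
  rw [add_sub_cancel] at h2
  linarith

theorem abs_rpow_mul_sub_le {v q r : ℝ} (hv : 0 < v) (hv1 : v < 1) (hq : 0 < q) (hr : 0 < r) :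
    |v ^ q * (1 + v) ^ (-r) - 2 ^ (-r)| ≤ (q + r + 2) * (1 - v) := by
  have hw : 0 < (1 + v) ^ (-r) := by positivity
  have hw1 : (1 + v) ^ (-r) ≤ 1 := Real.rpow_le_one_of_one_le_of_nonpos (by linarith) (by linarith)
  have hvq : v ^ q ≤ 1 := Real.rpow_le_one hv.le hv1.le hq.le
  have h1 := one_sub_rpow_le hv hv1.le hq
  have hu1 : (1 + v) / 2 ≤ 1 := by linarith
  have h2 := one_sub_rpow_le (u := (1 + v) / 2) (by linarith) hu1 hr
  have hur : ((1 + v) / 2) ^ r ≤ 1 := Real.rpow_le_one (by linarith) hu1 hr.le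
  have e : (2 : ℝ) ^ (-r) = (1 + v) ^ (-r) * ((1 + v) / 2) ^ r := by
    rw [Real.div_rpow (by linarith) (by norm_num), Real.rpow_neg two_pos.le,
      Real.rpow_neg (by linarith : (0 : ℝ) ≤ 1 + v)]
    have : (1 + v) ^ r ≠ 0 := (Real.rpow_pos_of_pos (by linarith) r).ne'
    field_simp
  rw [e, ← mul_comm ((1 + v) ^ (-r)), ← mul_sub, abs_mul, abs_of_pos hw]
  have h3 : |v ^ q - ((1 + v) / 2) ^ r| ≤ (q + r + 2) * (1 - v) := by
    rw [abs_le]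
    constructor <;> nlinarith
  calc _ ≤ 1 * |v ^ q - ((1 + v) / 2) ^ r| := by gcongr
    _ ≤ _ := by rwa [one_mul]

theorem exists_rieszSeries_sq_bounds {p lam : ℝ} (hl : -(1 / 2) < lam) (hp : 1 / 2 ≤ p) :
    ∃ A C, 0 < A ∧ 0 < C ∧ ∀ v : ℝ, 0 < v → v < 1 →
      v ^ (1 + lam) * (1 - v) ^ p * rieszSeries p lam (v ^ 2) ≤ C ∧
      |v ^ (1 + lam) * (1 - v) ^ p * rieszSeriesDeriv p lam (v ^ 2) - A / (1 - v)| ≤ C := by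
  obtain ⟨A, C, hA, hC, h⟩ := exists_rieszSeries_bounds hl hp
  refine ⟨A * 2 ^ (-(p + 1)), C + A * ((1 + lam) + (p + 1) + 2), by positivity, ?_, ?_⟩
  · have : 0 < (1 + lam) + (p + 1) + 2 := by linarith
    positivity
  intro v hv hv1
  have h1v : 0 < 1 - v := by linarith
  obtain ⟨hH, hH'⟩ := h (v ^ 2) (by positivity) (by nlinarith)
  have hV : v ^ (1 + lam) ≤ 1 := Real.rpow_le_one hv.le hv1.le (by linarith)
  have hV0 : 0 < v ^ (1 + lam) := by positivity
  have hP0 : 0 < (1 - v) ^ p := by positivity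
  have hfac : 1 - v ^ 2 = (1 - v) * (1 + v) := by ring
  have hsmall : v ^ (1 + lam) * (1 - v) ^ p * (C * (1 - v ^ 2) ^ (-p)) ≤ C := by
    have e : (1 - v) ^ p * (1 - v ^ 2) ^ (-p) = (1 + v) ^ (-p) := by
      rw [hfac, Real.mul_rpow h1v.le (by linarith), Real.rpow_neg h1v.le]
      field_simp
    have hle : (1 + v) ^ (-p) ≤ 1 :=
      Real.rpow_le_one_of_one_le_of_nonpos (by linarith) (by linarith)
    calc _ = C * (v ^ (1 + lam) * ((1 - v) ^ p * (1 - v ^ 2) ^ (-p))) := by ring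
      _ ≤ C * (1 * 1) := by rw [e]; gcongr
      _ = C := by ring
  have hx : 0 ≤ A * ((1 + lam) + (p + 1) + 2) := mul_nonneg hA.le (by linarith)
  constructor
  · calc _ ≤ v ^ (1 + lam) * (1 - v) ^ p * (C * (1 - v ^ 2) ^ (-p)) := by gcongr
      _ ≤ C := hsmall
      _ ≤ _ := by linarith
  · have hmain : (1 - v) ^ p * (1 - v ^ 2) ^ (-(p + 1)) = (1 + v) ^ (-(p + 1)) / (1 - v) := by
      rw [hfac, Real.mul_rpow h1v.le (by linarith), Real.rpow_neg h1v.le, Real.rpow_add_one h1v.ne']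
      field_simp
    have hsplit : v ^ (1 + lam) * (1 - v) ^ p * rieszSeriesDeriv p lam (v ^ 2) -
        A * 2 ^ (-(p + 1)) / (1 - v) =
        v ^ (1 + lam) * (1 - v) ^ p *
          (rieszSeriesDeriv p lam (v ^ 2) - A * (1 - v ^ 2) ^ (-(p + 1))) +
        A * (v ^ (1 + lam) * (1 + v) ^ (-(p + 1)) - 2 ^ (-(p + 1))) / (1 - v) := by
      linear_combination v ^ (1 + lam) * A * hmain
    have hdiff := abs_rpow_mul_sub_le hv hv1 (show 0 < 1 + lam by linarith)
      (show 0 < p + 1 by linarith)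
    rw [hsplit]
    refine (abs_add_le _ _).trans (add_le_add ?_ ?_)
    · rw [abs_mul, abs_of_pos (mul_pos hV0 hP0)]
      exact (mul_le_mul_of_nonneg_left hH' (by positivity)).trans hsmall
    · rw [abs_div, abs_mul, abs_of_pos hA, abs_of_pos h1v, div_le_iff₀ h1v, mul_assoc]
      gcongr

theorem exists_rieszSeries_le_near_zero {p lam C : ℝ} (hl : -(1 / 2) < lam) (hp : 1 / 2 ≤ p)
    (hC : rieszCoeff p lam 0 < C) :
    ∃ z₀, 0 < z₀ ∧ z₀ < 1 ∧ ∀ z, 0 ≤ z → z ≤ z₀ → rieszSeries p lam z ≤ C := by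
  have h0 : rieszSeries p lam 0 = rieszCoeff p lam 0 := by
    unfold rieszSeries
    rw [tsum_eq_single 0 fun k hk => by simp [hk]]
    simp
  have hc := (hasDerivAt_rieszSeries hl hp (z := 0) (by simp)).continuousAt
  have hev := hc.eventually (gt_mem_nhds (by rwa [h0]))
  obtain ⟨r, hr, hball⟩ := Metric.eventually_nhds_iff.1 hev
  refine ⟨min (r / 2) (1 / 2), by positivity, by
    have := min_le_right (r / 2) (1 / 2); linarith, fun z hz hz' => (hball ?_).le⟩
  rw [Real.dist_eq, sub_zero, abs_of_nonneg hz]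
  have := min_le_left (r / 2) (1 / 2)
  linarith

theorem exists_le_rieszSeries_combination {p lam : ℝ} (hl : -(1 / 2) < lam) (hp : 1 / 2 ≤ p) :
    ∃ δ c, 0 < δ ∧ δ ≤ 1 ∧ 0 < c ∧ ∀ a b h A : ℝ, 0 < a → 0 < b → 0 ≤ h → A = h + a ^ 2 + b ^ 2 →
      a ^ 2 ≤ δ * b ^ 2 → (lam + 1 / 2) / (lam + 1) < b ^ 2 / (b ^ 2 + h) →
      c ≤ 4 * (b ^ 2 * (A - 2 * a ^ 2) / A ^ 2) *
          rieszSeriesDeriv p lam ((2 * (a * b) / A) ^ 2) -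
        (p + lam) * rieszSeries p lam ((2 * (a * b) / A) ^ 2) := by
  have hl1 : 0 < lam + 1 := by linarith
  have hl2 : 0 < lam + 1 / 2 := by linarith
  have hμ : 0 < p + lam := by linarith
  have hp0 : 0 < p := by linarith
  have hq0 := rieszCoeff_pos hl hp 0
  have hq1 := rieszCoeff_pos hl hp 1
  have hq := rieszCoeff_succ hl hp 0
  norm_num only [Nat.cast_zero] at hq
  set q₀ := rieszCoeff p lam 0
  set q₁ := rieszCoeff p lam 1
  set k := p / (lam + 1) with hk
  have hk0 : 0 < k := by positivity
  obtain ⟨z₀, hz0, hz1, hz⟩ := exists_rieszSeries_le_near_zero (C := q₀ * (1 + k / 4)) hl hp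
    (by nlinarith)
  set δ := min (z₀ / 4) (k / (12 * (1 + k))) with hδ
  have hδ0 : 0 < δ := by positivity
  have hδz : δ ≤ z₀ / 4 := min_le_left _ _
  have hδk : 12 * (1 + k) * δ ≤ k := by
    have := min_le_right (z₀ / 4) (k / (12 * (1 + k)))
    rw [← hδ, le_div_iff₀ (by positivity)] at this
    linarith
  refine ⟨δ, (p + lam) * q₀ * k / 2, hδ0, by linarith, by positivity, ?_⟩
  intro a b h A ha hb hh hA hab hL
  have hA0 : 0 < A := by rw [hA]; positivity
  have haA : a ^ 2 ≤ δ * A := by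
    refine hab.trans (mul_le_mul_of_nonneg_left ?_ hδ0.le)
    rw [hA]; nlinarith [sq_nonneg a]
  have hzle : (2 * (a * b) / A) ^ 2 ≤ z₀ := by
    rw [div_pow, div_le_iff₀ (by positivity)]
    have hbA : b ^ 2 ≤ A := by rw [hA]; nlinarith [sq_nonneg a]
    calc (2 * (a * b)) ^ 2 = 4 * (a ^ 2 * b ^ 2) := by ring
      _ ≤ 4 * (δ * A * A) := by gcongr
      _ ≤ 4 * (z₀ / 4 * A * A) := by gcongr
      _ = z₀ * A ^ 2 := by ring
  have hH := hz _ (sq_nonneg (2 * (a * b) / A)) hzle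
  have hH' := le_rieszSeriesDeriv hl hp (sq_nonneg (2 * (a * b) / A)) (hzle.trans_lt hz1)
  set L := (lam + 1 / 2) / (lam + 1) with hLdef
  have hL0 : 0 < L := by positivity
  rw [lt_div_iff₀ (by positivity)] at hL
  have hδ3 : 12 * δ ≤ 1 := by nlinarith
  have hX : L * (1 - 3 * δ) ≤ b ^ 2 * (A - 2 * a ^ 2) / A ^ 2 := by
    rw [le_div_iff₀ (by positivity)]
    have h1 : (1 - 2 * δ) * A ≤ A - 2 * a ^ 2 := by linarith
    have h2 : L * ((1 - δ) * A) ≤ b ^ 2 := by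
      refine le_trans (mul_le_mul_of_nonneg_left ?_ hL0.le) hL.le
      rw [hA] at haA ⊢; linarith
    calc L * (1 - 3 * δ) * A ^ 2 ≤ L * ((1 - δ) * (1 - 2 * δ)) * A ^ 2 := by
          gcongr; nlinarith
      _ = L * ((1 - δ) * A) * ((1 - 2 * δ) * A) := by ring
      _ ≤ _ := by
          refine mul_le_mul h2 h1 (mul_nonneg (by linarith) hA0.le) (by positivity)
  have hLq : 4 * L * q₁ = q₀ * (p + lam) * (1 + k) := by
    rw [hLdef, hk]
    field_simp
    linear_combination 8 * hq
  have hmain : 4 * (L * (1 - 3 * δ)) * q₁ ≤ 4 * (b ^ 2 * (A - 2 * a ^ 2) / A ^ 2) *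
      rieszSeriesDeriv p lam ((2 * (a * b) / A) ^ 2) := by
    have : 0 < L * (1 - 3 * δ) := mul_pos hL0 (by linarith)
    exact mul_le_mul (by linarith) hH' hq1.le (by linarith)
  have hsub := mul_le_mul_of_nonneg_left hH hμ.le
  have hgap : 0 ≤ (p + lam) * q₀ * (k / 4 - 3 * δ * (1 + k)) :=
    mul_nonneg (by positivity) (by linarith)
  linear_combination hmain + hsub + hgap - (1 - 3 * δ) * hLq

theorem horizSq_nonneg (n : ℕ) (x y : HalfPt n) : 0 ≤ horizSq n x y :=
  Finset.sum_nonneg fun _ _ => sq_nonneg _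

theorem exists_le_rieszKerLast {n : ℕ} (hn : 1 ≤ n) {lam : ℝ} (hlam : -(1 / 2 : ℝ) < lam) :
    ∃ Ct ct : ℝ, 0 < Ct ∧ 1 ≤ ct ∧ ∀ x y : HalfPt n, 0 < x.2 → x.2 ≤ y.2 / ct →
      (lam + 1 / 2) / (lam + 1) < y.2 ^ 2 / (y.2 ^ 2 + horizSq n x y) →
      Ct * x.2 / (y.2 ^ 2 + horizSq n x y) ^ ((n : ℝ) / 2 + lam + 1) ≤ rieszKerLast n lam x y := by
  have hn' : (1 : ℝ) ≤ n := by exact_mod_cast hn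
  have hp : 1 / 2 ≤ (n : ℝ) / 2 := by linarith
  obtain ⟨δ, c, hδ, hδ1, hc, H⟩ := exists_le_rieszSeries_combination hlam hp
  set κ := (Real.sqrt Real.pi)⁻¹ * Real.pi ^ (-((n : ℝ) / 2)) with hκ
  have hκ0 : 0 < κ := by have := Real.pi_pos; positivity
  set μ := (n : ℝ) / 2 + lam with hμ
  have hδinv : 0 < 1 / δ := by positivity
  refine ⟨κ * 2 ^ (-μ - 1) * 2 * c, 1 + 1 / δ, by positivity, by linarith, ?_⟩
  intro x y hx hxy hL
  have hh := horizSq_nonneg n x y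
  rw [le_div_iff₀ (by linarith)] at hxy
  have hxy' : x.2 < y.2 := by nlinarith
  have hy : 0 < y.2 := hx.trans hxy'
  have hxδ : x.2 ≤ δ * y.2 := by
    have h1 : x.2 * (1 / δ) ≤ y.2 := by nlinarith
    rw [mul_one_div, div_le_iff₀ hδ] at h1
    linarith
  have hsq : x.2 ^ 2 ≤ δ * y.2 ^ 2 := by nlinarith [mul_pos hx hy]
  have hD : 0 < horizSq n x y + (x.2 - y.2) ^ 2 := by nlinarith [sq_pos_of_pos (sub_pos.2 hxy')]
  rw [rieszKerLast_eq hn hlam rfl hx hy hD, ← hκ, ← hμ]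
  have hB := H x.2 y.2 (horizSq n x y) _ hx hy hh rfl hsq hL
  set S := y.2 ^ 2 + horizSq n x y with hS
  have hS0 : 0 < S := by positivity
  have hA0 : 0 < horizSq n x y + x.2 ^ 2 + y.2 ^ 2 := by positivity
  have hAS : horizSq n x y + x.2 ^ 2 + y.2 ^ 2 ≤ 2 * S := by nlinarith
  have hpow : (2 * S) ^ (-μ - 1) ≤ (horizSq n x y + x.2 ^ 2 + y.2 ^ 2) ^ (-μ - 1) :=
    Real.rpow_le_rpow_of_nonpos hA0 hAS (by linarith)
  calc κ * 2 ^ (-μ - 1) * 2 * c * x.2 / S ^ (μ + 1)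
      = κ * (2 * S) ^ (-μ - 1) * (2 * x.2) * c := by
        rw [Real.mul_rpow two_pos.le hS0.le, show -μ - 1 = -(μ + 1) by ring,
          Real.rpow_neg hS0.le]
        field_simp
    _ ≤ _ := by gcongr

theorem fullDist_pow {n : ℕ} {x y : HalfPt n} (m : ℕ) :
    fullDist n x y ^ m = (horizSq n x y + (x.2 - y.2) ^ 2) ^ ((m : ℝ) / 2) := by
  have h : 0 ≤ horizSq n x y + (x.2 - y.2) ^ 2 := add_nonneg (horizSq_nonneg n x y) (sq_nonneg _)
  rw [fullDist, Real.sqrt_eq_rpow, ← Real.rpow_natCast, ← Real.rpow_mul h]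
  congr 1; ring

theorem horizSq_add_sq_pos {n : ℕ} {x y : HalfPt n} (hxy : x ≠ y) :
    0 < horizSq n x y + (x.2 - y.2) ^ 2 := by
  refine lt_of_le_of_ne (add_nonneg (horizSq_nonneg n x y) (sq_nonneg _)) fun h => hxy ?_
  have h1 : horizSq n x y = 0 := by nlinarith [horizSq_nonneg n x y, sq_nonneg (x.2 - y.2)]
  have h2 : (x.2 - y.2) ^ 2 = 0 := by linarith
  refine Prod.ext (funext fun i => ?_) (sub_eq_zero.1 (pow_eq_zero_iff two_ne_zero |>.1 h2))
  have := (Finset.sum_eq_zero_iff_of_nonneg fun i _ => sq_nonneg (x.1 i - y.1 i)).1 h1 i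
    (Finset.mem_univ i)
  exact sub_eq_zero.1 (pow_eq_zero_iff two_ne_zero |>.1 this)

theorem abs_combination_sub_le {a b h A D c C μ F G : ℝ} (ha : 0 < a) (hb : 0 < b) (hh : 0 ≤ h)
    (hA : A = h + a ^ 2 + b ^ 2) (hD : D = h + (a - b) ^ 2) (hD0 : 0 < D) (hc : 0 ≤ c)
    (hμ : 0 ≤ μ) (hF0 : 0 ≤ F) (hF : F ≤ C) (hG : |G - c / (D / A)| ≤ C) :
    |2 * (4 * (b ^ 2 * (A - 2 * a ^ 2) / A ^ 2) * G - μ * F) - 8 * c * ((b - a) * b / D)| ≤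
      8 * c + 8 * C + 2 * μ * C := by
  have hA0 : 0 < A := by rw [hA]; positivity
  set X := b ^ 2 * (A - 2 * a ^ 2) / A ^ 2 with hX
  have hX1 : |X| ≤ 1 := by
    rw [hX, abs_div, abs_mul, abs_of_pos (by positivity : 0 < A ^ 2), abs_of_pos (pow_pos hb 2),
      div_le_one (by positivity), pow_two A]
    refine mul_le_mul ?_ (abs_le.2 ⟨?_, ?_⟩) (abs_nonneg _) hA0.le <;> rw [hA] <;>
      nlinarith [sq_nonneg a, sq_nonneg b]
  have hab : |a * b / A| ≤ 1 := by
    rw [abs_of_pos (by positivity), div_le_one hA0, hA]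
    nlinarith [sq_nonneg (a - b), mul_pos ha hb]
  have hid : X * (c / (D / A)) - c * ((b - a) * b / D) = c * (a * b / A) := by
    have hDA : D = A - 2 * a * b := by rw [hA, hD]; ring
    rw [hX]
    field_simp
    rw [hDA]
    ring
  have hsplit : 2 * (4 * X * G - μ * F) - 8 * c * ((b - a) * b / D) =
      8 * (X * (G - c / (D / A))) + 8 * (c * (a * b / A)) - 2 * μ * F := by
    linear_combination 8 * hid
  have h1 : |X * (G - c / (D / A))| ≤ C := by
    rw [abs_mul]
    calc _ ≤ 1 * C := mul_le_mul hX1 hG (abs_nonneg _) zero_le_one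
      _ = C := one_mul C
  have h2 : |c * (a * b / A)| ≤ c := by
    rw [abs_mul, abs_of_nonneg hc]
    exact mul_le_of_le_one_right hc hab
  have h3 : 0 ≤ μ * F := mul_nonneg hμ hF0
  have h4 : μ * F ≤ μ * C := mul_le_mul_of_nonneg_left hF hμ
  rw [hsplit]
  rw [abs_le] at h1 h2 ⊢
  have h5 : 0 ≤ μ * C := h3.trans h4
  constructor <;> linarith [h1.1, h1.2, h2.1, h2.2]

theorem rpow_neg_eq_mul_rpow {A D a b p lam : ℝ} (hA : 0 < A) (hD : 0 < D) (ha : 0 < a)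
    (hb : 0 < b) :
    A ^ (-(p + lam) - 1) * a = 2 ^ (-(1 + lam)) * ((a * b) ^ (-lam) * b⁻¹ * D ^ (-p)) *
      ((2 * (a * b) / A) ^ (1 + lam) * (D / A) ^ p) := by
  have hab : 0 < a * b := mul_pos ha hb
  have e1 : (a * b) ^ (-lam) * (a * b) ^ (1 + lam) = a * b := by
    rw [← Real.rpow_add hab, show -lam + (1 + lam) = 1 by ring, Real.rpow_one]
  have e2 : A ^ (-(p + lam) - 1) = (A ^ (1 + lam))⁻¹ * (A ^ p)⁻¹ := by
    rw [← Real.rpow_neg hA.le, ← Real.rpow_neg hA.le, ← Real.rpow_add hA]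
    congr 1; ring
  rw [Real.div_rpow (by positivity) hA.le, Real.div_rpow hD.le hA.le,
    Real.mul_rpow two_pos.le hab.le, e2, Real.rpow_neg two_pos.le, Real.rpow_neg hD.le]
  have h2 : (2 : ℝ) ^ (1 + lam) ≠ 0 := by positivity
  have h3 : D ^ p ≠ 0 := by positivity
  generalize (2 : ℝ) ^ (1 + lam) = t at *
  generalize D ^ p = d at *
  generalize (a * b) ^ (-lam) = u at *
  generalize (a * b) ^ (1 + lam) = w at *
  generalize A ^ (1 + lam) = f at *
  generalize A ^ p = g at *
  field_simp
  linear_combination -f⁻¹ * g⁻¹ * e1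

theorem exists_abs_rieszKerLast_sub_le {n : ℕ} (hn : 1 ≤ n) {lam : ℝ}
    (hlam : -(1 / 2 : ℝ) < lam) :
    ∃ Cn Co : ℝ, 0 < Cn ∧ 0 < Co ∧ ∀ x y : HalfPt n, 0 < x.2 → 0 < y.2 → x ≠ y →
      |rieszKerLast n lam x y -
          Cn * (y.2 - x.2) / ((x.2 * y.2) ^ lam * fullDist n x y ^ (n + 2))| ≤
        Co / (x.2 ^ lam * y.2 ^ (lam + 1) * fullDist n x y ^ n) := by
  have hn' : (1 : ℝ) ≤ n := by exact_mod_cast hn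
  have hp : 1 / 2 ≤ (n : ℝ) / 2 := by linarith
  obtain ⟨c, C, hc, hC, H⟩ := exists_rieszSeries_sq_bounds hlam hp
  set κ := (Real.sqrt Real.pi)⁻¹ * Real.pi ^ (-((n : ℝ) / 2)) with hκ
  have hκ0 : 0 < κ := by have := Real.pi_pos; positivity
  have hμ : 0 < (n : ℝ) / 2 + lam := by linarith
  set θ : ℝ := 2 ^ (-(1 + lam)) with hθ
  have hθ0 : 0 < θ := by positivity
  refine ⟨κ * θ * (8 * c), κ * θ * (8 * c + 8 * C + 2 * ((n : ℝ) / 2 + lam) * C), by positivity,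
    by positivity, ?_⟩
  intro x y hx hy hxy
  have hh := horizSq_nonneg n x y
  have hD0 := horizSq_add_sq_pos hxy
  rw [fullDist_pow, fullDist_pow, rieszKerLast_eq hn hlam rfl hx hy hD0, ← hκ]
  set D := horizSq n x y + (x.2 - y.2) ^ 2 with hD
  set A := horizSq n x y + x.2 ^ 2 + y.2 ^ 2 with hA
  have hA0 : 0 < A := by positivity
  have hDA : D = A - 2 * (x.2 * y.2) := by rw [hA, hD]; ring
  have hab : 0 < x.2 * y.2 := mul_pos hx hy
  have hv0 : 0 < 2 * (x.2 * y.2) / A := by positivity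
  have hv1 : 2 * (x.2 * y.2) / A < 1 := by rw [div_lt_one hA0]; linarith
  have h1v : 1 - 2 * (x.2 * y.2) / A = D / A := by rw [hDA]; field_simp
  obtain ⟨hF, hG⟩ := H _ hv0 hv1
  rw [h1v] at hF hG
  have hser := rieszSeries_nonneg hlam hp (sq_nonneg (2 * (x.2 * y.2) / A))
  have hmain := abs_combination_sub_le hx hy hh hA hD hD0 hc.le hμ.le (by positivity) hF hG
  set T := (x.2 * y.2) ^ (-lam) * y.2⁻¹ * D ^ (-((n : ℝ) / 2)) with hT
  have hT0 : 0 < T := by positivity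
  have hpow := rpow_neg_eq_mul_rpow (p := (n : ℝ) / 2) (lam := lam) hA0 hD0 hx hy
  rw [← hT, ← hθ] at hpow
  have e1 : κ * θ * (8 * c) * (y.2 - x.2) / ((x.2 * y.2) ^ lam * D ^ (((n + 2 : ℕ) : ℝ) / 2)) =
      κ * θ * T * (8 * c * ((y.2 - x.2) * y.2 / D)) := by
    rw [hT, Real.rpow_neg hab.le, Real.rpow_neg hD0.le,
      show ((n + 2 : ℕ) : ℝ) / 2 = (n : ℝ) / 2 + 1 by push_cast; ring, Real.rpow_add_one hD0.ne']
    field_simp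
  have e2 : ∀ M : ℝ, κ * θ * M / (x.2 ^ lam * y.2 ^ (lam + 1) * D ^ ((n : ℝ) / 2)) =
      κ * θ * T * M := by
    intro M
    rw [hT, Real.rpow_neg hab.le, Real.rpow_neg hD0.le, Real.rpow_add_one hy.ne',
      Real.mul_rpow hx.le hy.le]
    field_simp
  rw [e1, e2]
  have e3 : ∀ X Y Z W : ℝ, κ * A ^ (-((n : ℝ) / 2 + lam) - 1) * (2 * x.2) *
      (X * Y - Z * W) = κ * θ * T *
      (2 * (X * ((2 * (x.2 * y.2) / A) ^ (1 + lam) * (D / A) ^ ((n : ℝ) / 2) * Y) -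
        Z * ((2 * (x.2 * y.2) / A) ^ (1 + lam) * (D / A) ^ ((n : ℝ) / 2) * W))) := by
    intro X Y Z W
    linear_combination 2 * κ * (X * Y - Z * W) * hpow
  rw [e3, ← mul_sub, abs_mul, abs_of_pos (by positivity : 0 < κ * θ * T)]
  gcongr

/-- Lemma 7.7: estimates for the kernel `R_{λ,n+1}(x,y)` of the
vertical Riesz transform associated with the Bessel operator `Δ_λ^{(n+1)}` on `ℝ^{n+1}_+`:
(i) for `0 < x_{n+1} ≤ y_{n+1}/c̃` and
`(λ+1/2)/(λ+1) < y_{n+1}²/(y_{n+1}² + |x'-y'|²) < 1`, the kernel does not change sign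
and `|R_{λ,n+1}(x,y)| ≥ C̃ x_{n+1} / (y_{n+1}² + |x'-y'|²)^{n/2+λ+1}`;
(ii) `R_{λ,n+1}(x,y) = C_n (y_{n+1} - x_{n+1})/((x_{n+1} y_{n+1})^λ |x-y|^{n+2})
  + O(1/(x_{n+1}^λ y_{n+1}^{λ+1} |x-y|^n))`. -/
theorem bessel_riesz_kernel_estimates_vertical
    (n : ℕ) (hn : 1 ≤ n) (lam : ℝ) (hlam : -(1 / 2 : ℝ) < lam) :
    (∃ Ct ct : ℝ, 0 < Ct ∧ 1 ≤ ct ∧ ∃ ε : ℝ, (ε = 1 ∨ ε = -1) ∧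
      ∀ x y : HalfPt n, 0 < x.2 → x.2 ≤ y.2 / ct →
        (lam + 1 / 2) / (lam + 1) < y.2 ^ 2 / (y.2 ^ 2 + horizSq n x y) →
        y.2 ^ 2 / (y.2 ^ 2 + horizSq n x y) < 1 →
        Ct * x.2 / (y.2 ^ 2 + horizSq n x y) ^ ((n : ℝ) / 2 + lam + 1) ≤
          ε * rieszKerLast n lam x y) ∧
    (∃ Cn Co : ℝ, 0 < Cn ∧ 0 < Co ∧
      ∀ x y : HalfPt n, 0 < x.2 → 0 < y.2 → x ≠ y →
        |rieszKerLast n lam x y -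
            Cn * (y.2 - x.2) / ((x.2 * y.2) ^ lam * fullDist n x y ^ (n + 2))| ≤
          Co / (x.2 ^ lam * y.2 ^ (lam + 1) * fullDist n x y ^ n)) := by
  refine ⟨?_, exists_abs_rieszKerLast_sub_le hn hlam⟩
  obtain ⟨Ct, ct, hCt, hct, H⟩ := exists_le_rieszKerLast hn hlam
  refine ⟨Ct, ct, hCt, hct, 1, Or.inl rfl, fun x y hx hxy hL _ => ?_⟩
  rw [one_mul]
  exact H x y hx hxy hL

end
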